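/- arXiv:0911.2214 — 2 statements merged into one kernel-verified Lean document; each statement's English description precedes it below -/
import Mathlib

section
/- Let S be a set of k vertices with k ∈ {2, 3} and let c be a constraint on S. Then c is fragile if and only if c is weakly fragile. -/
open scoped Classical

universe u

noncomputable section

variable {α : Type u}

/-- `f` and `g` order the elements of `S` the same way. -/
def SameOrderOn (S : Finset α) (f g : α → ℝ) : Prop :=
  ∀ x ∈ S, ∀ y ∈ S, (f x < f y ↔ g x < g y)

/-- An ordering of `S` is an injection of `S` into `ℝ`. -/
def IsOrderingOn (S : Finset α) (σ : α → ℝ) : Prop :=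
  Set.InjOn σ ↑S

/-- A ranking of `S` is a bijection from `S` onto `{1, …, |S|}`. -/
def IsRankingOn (S : Finset α) (π : α → ℝ) : Prop :=
  Set.BijOn π ↑S ((fun i : ℕ => (i : ℝ)) '' Set.Icc 1 S.card)

/-- The rankings `π` and `π'` of `S` differ by the move of a single vertex:
`π' = Ranking(v ↦ p ⊕ π|_{S∖{v}})` for some `v ∈ S` and half-integer `p`,
and the two rankings differ. -/
def SingleMove (S : Finset α) (π π' : α → ℝ) : Prop :=
  ∃ v ∈ S, ∃ p : ℝ, (∃ m : ℤ, p = (m : ℝ) + 1 / 2) ∧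
    SameOrderOn S π' (Function.update π v p) ∧ ∃ x ∈ S, π x ≠ π' x

/-- The rankings `π` and `π'` of `S` differ by one of the four weak single-vertex moves:
swap the first two vertices, swap the last two, or move the first or last vertex to the
other end; formally `π' = Ranking(v ↦ p ⊕ π|_{S∖{v}})` with
`(π v, p) ∈ {(1, 2+1/2), (1, k+1/2), (k, k−3/2), (k, 1/2)}` where `k = |S|`. -/
def WeakMove (S : Finset α) (π π' : α → ℝ) : Prop :=
  ∃ v ∈ S, ∃ p : ℝ,
    ((π v = 1 ∧ p = 2 + 1 / 2) ∨ (π v = 1 ∧ p = (S.card : ℝ) + 1 / 2) ∨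
      (π v = (S.card : ℝ) ∧ p = (S.card : ℝ) - 3 / 2) ∨
      (π v = (S.card : ℝ) ∧ p = 1 / 2)) ∧
    SameOrderOn S π' (Function.update π v p) ∧ ∃ x ∈ S, π x ≠ π' x

/-- A constraint `c` on `S` is fragile if any two rankings of `S` differing by the move of
a single vertex satisfy `c π + c π' ≥ 1`. -/
def FragileOn (S : Finset α) (c : (α → ℝ) → ℕ) : Prop :=
  ∀ π π' : α → ℝ, IsRankingOn S π → IsRankingOn S π' → SingleMove S π π' → 1 ≤ c π + c π'

/-- A constraint `c` on `S` is weakly fragile if any two rankings of `S` differing by one of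
the four weak moves satisfy `c π + c π' ≥ 1`. -/
def WeaklyFragileOn (S : Finset α) (c : (α → ℝ) → ℕ) : Prop :=
  ∀ π π' : α → ℝ, IsRankingOn S π → IsRankingOn S π' → WeakMove S π π' → 1 ≤ c π + c π'

/-- A (fully dense) arity-`k` constraint system on `U`: to every `k`-subset `S` of `U` it
assigns a `{0,1}`-valued cost `c S` which depends only on the relative order of its
argument on `S` (so `c S σ` is the cost of the ranking of `S` induced by `σ`). -/
def IsConstraintSystem (U : Finset α) (k : ℕ) (c : Finset α → (α → ℝ) → ℕ) : Prop :=
  ∀ S ∈ U.powersetCard k,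
    (∀ σ : α → ℝ, c S σ ≤ 1) ∧ ∀ σ σ' : α → ℝ, SameOrderOn S σ σ' → c S σ = c S σ'

/-- Every constraint of the system is weakly fragile. -/
def WeaklyFragileSystem (U : Finset α) (k : ℕ) (c : Finset α → (α → ℝ) → ℕ) : Prop :=
  ∀ S ∈ U.powersetCard k, WeaklyFragileOn S (c S)

/-- The cost `C^c(σ) = Σ_{S ⊆ U, |S| = k} c(σ|_S)` of an ordering `σ`. -/
def cost (U : Finset α) (k : ℕ) (c : Finset α → (α → ℝ) → ℕ) (σ : α → ℝ) : ℕ :=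
  ∑ S ∈ U.powersetCard k, c S σ

/-- `b^c(σ, v, p) = Σ_{Q ⊆ U∖{v}, |Q| = k−1} c(σ|_Q ⊕ v ↦ p)`: the cost of the
constraints involving `v` after moving `v` to position `p` (here `U` is the domain of `σ`). -/
def bcost (U : Finset α) (k : ℕ) (c : Finset α → (α → ℝ) → ℕ) (σ : α → ℝ) (v : α) (p : ℝ) : ℕ :=
  ∑ Q ∈ (U.erase v).powersetCard (k - 1), c (insert v Q) (Function.update σ v p)

/-- The rank of `x` within `S` under the ordering `σ`. -/
def rk (S : Finset α) (σ : α → ℝ) (x : α) : ℕ :=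
  (S.filter fun y => σ y ≤ σ x).card

/-- The ordering of `S` obtained from `σ` by moving `v` to a position immediately
before `u` (all other vertices of `S` keeping their relative order). -/
def moveBefore (S : Finset α) (σ : α → ℝ) (v u : α) : α → ℝ :=
  Function.update (fun x => (rk S σ x : ℝ)) v ((rk S σ u : ℝ) - 1 / 2)

/-- The feedback-arc-set weight `w^σ_{uv}`: the number of `k`-subsets
`{u,v} ⊆ S ⊆ U` with `c(σ') = 1`, where `σ' = σ|_{S∖{v}} ⊕ v ↦ p` and `p` places `v`
immediately before `u` if `σ v > σ u`, and `p = σ v` otherwise. -/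
def wgt (U : Finset α) (k : ℕ) (c : Finset α → (α → ℝ) → ℕ) (σ : α → ℝ) (u v : α) : ℕ :=
  ((U.powersetCard k).filter fun S =>
    u ∈ S ∧ v ∈ S ∧ if σ u < σ v then c S (moveBefore S σ v u) = 1 else c S σ = 1).card

/-- The canceled weights
`w̄^σ_{uv} = w^σ_{uv} − min((1/(10·3^{k−1}))·C(|U|−2, k−2), w^σ_{uv}, w^σ_{vu})`. -/
def wbar (U : Finset α) (k : ℕ) (c : Finset α → (α → ℝ) → ℕ) (σ : α → ℝ) (u v : α) : ℝ :=
  (wgt U k c σ u v : ℝ) -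
    min (1 / (10 * 3 ^ (k - 1)) * ((U.card - 2).choose (k - 2) : ℝ))
      (min (wgt U k c σ u v : ℝ) (wgt U k c σ v u : ℝ))

/-- The feedback-arc-set cost `C^w(σ) = Σ_{u,v ∈ U : σ(u) > σ(v)} w_{uv}`. -/
def costW (U : Finset α) (w : α → α → ℝ) (σ : α → ℝ) : ℝ :=
  ∑ x ∈ U, ∑ y ∈ U, if σ y < σ x then w x y else 0

/-- `b^w(σ, v, p) = Σ_{u ≠ v} (w_{uv} if σ(u) > p, w_{vu} if σ(u) < p)`. -/
def bW (U : Finset α) (w : α → α → ℝ) (σ : α → ℝ) (v : α) (p : ℝ) : ℝ :=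
  ∑ x ∈ U.erase v, if p < σ x then w x v else if σ x < p then w v x else 0

/-- The Kendall tau distance: the number of `σ/σ'`-inversions, i.e. of unordered pairs
`{u,v} ⊆ S` on which `σ` and `σ'` disagree. -/
def kendall (S : Finset α) (σ σ' : α → ℝ) : ℕ :=
  ((S ×ˢ S).filter fun q => σ q.1 < σ q.2 ∧ σ' q.2 < σ' q.1).card

/-- `Round(π)`: each position is rounded down to the nearest multiple of `e = εn`, with
ties broken by adding `u/(n+1)`. -/
def roundOrd (n e : ℕ) (π : ℕ → ℝ) : ℕ → ℝ :=
  fun u => (e : ℝ) * (⌊π u / (e : ℝ)⌋ : ℝ) + (u : ℝ) / ((n : ℝ) + 1)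

end

theorem IsRankingOn.eq_natCast {α : Type u} {S : Finset α} {π : α → ℝ} (h : IsRankingOn S π)
    {x : α} (hx : x ∈ S) : ∃ i : ℕ, 1 ≤ i ∧ i ≤ S.card ∧ π x = i := by
  obtain ⟨i, ⟨h1, h2⟩, hi⟩ := h.mapsTo hx
  exact ⟨i, h1, h2, hi.symm⟩

theorem IsRankingOn.exists_mem_eq {α : Type u} {S : Finset α} {π : α → ℝ} (h : IsRankingOn S π)
    {i : ℕ} (h1 : 1 ≤ i) (h2 : i ≤ S.card) : ∃ x ∈ S, π x = i :=
  h.surjOn ⟨i, ⟨h1, h2⟩, rfl⟩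

theorem IsRankingOn.eq_one_or_two {α : Type u} {S : Finset α} {π : α → ℝ} (h : IsRankingOn S π)
    (hS : S.card = 2) {x : α} (hx : x ∈ S) : π x = 1 ∨ π x = 2 := by
  obtain ⟨i, h1, h2, hi⟩ := h.eq_natCast hx
  rw [hS] at h2
  interval_cases i <;> simp [hi]

theorem IsRankingOn.eq_one_or_two_or_three {α : Type u} {S : Finset α} {π : α → ℝ}
    (h : IsRankingOn S π) (hS : S.card = 3) {x : α} (hx : x ∈ S) :
    π x = 1 ∨ π x = 2 ∨ π x = 3 := by
  obtain ⟨i, h1, h2, hi⟩ := h.eq_natCast hx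
  rw [hS] at h2
  interval_cases i <;> simp [hi]

theorem IsRankingOn.exists_eq_pair {α : Type u} {S : Finset α} {π : α → ℝ} (h : IsRankingOn S π)
    (hS : S.card = 2) : ∃ x y, S = {x, y} ∧ π x = 1 ∧ π y = 2 := by
  obtain ⟨x, hx, hx1⟩ := h.exists_mem_eq (i := 1) (by lia) (by lia)
  obtain ⟨y, hy, hy2⟩ := h.exists_mem_eq (i := 2) (by lia) (by lia)
  push_cast at hx1 hy2
  refine ⟨x, y, ?_, hx1, hy2⟩
  ext z
  simp only [Finset.mem_insert, Finset.mem_singleton]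
  refine ⟨fun hz => ?_, by rintro (rfl | rfl) <;> assumption⟩
  rcases h.eq_one_or_two hS hz with e | e
  · exact .inl (h.injOn hz hx (e.trans hx1.symm))
  · exact .inr (h.injOn hz hy (e.trans hy2.symm))

theorem IsRankingOn.exists_eq_triple {α : Type u} {S : Finset α} {π : α → ℝ}
    (h : IsRankingOn S π) (hS : S.card = 3) :
    ∃ x y z, S = {x, y, z} ∧ π x = 1 ∧ π y = 2 ∧ π z = 3 := by
  obtain ⟨x, hx, hx1⟩ := h.exists_mem_eq (i := 1) (by lia) (by lia)
  obtain ⟨y, hy, hy2⟩ := h.exists_mem_eq (i := 2) (by lia) (by lia)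
  obtain ⟨z, hz, hz3⟩ := h.exists_mem_eq (i := 3) (by lia) (by lia)
  push_cast at hx1 hy2 hz3
  refine ⟨x, y, z, ?_, hx1, hy2, hz3⟩
  ext w
  simp only [Finset.mem_insert, Finset.mem_singleton]
  refine ⟨fun hw => ?_, by rintro (rfl | rfl | rfl) <;> assumption⟩
  rcases h.eq_one_or_two_or_three hS hw with e | e | e
  · exact .inl (h.injOn hw hx (e.trans hx1.symm))
  · exact .inr (.inl (h.injOn hw hy (e.trans hy2.symm)))
  · exact .inr (.inr (h.injOn hw hz (e.trans hz3.symm)))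

theorem WeakMove.singleMove {α : Type u} {S : Finset α} {π π' : α → ℝ} (h : WeakMove S π π') :
    SingleMove S π π' := by
  obtain ⟨v, hv, p, hp, hrest⟩ := h
  refine ⟨v, hv, p, ?_, hrest⟩
  rcases hp with ⟨-, rfl⟩ | ⟨-, rfl⟩ | ⟨-, rfl⟩ | ⟨-, rfl⟩
  · exact ⟨2, by norm_num⟩
  · exact ⟨S.card, by push_cast; rfl⟩
  · exact ⟨S.card - 2, by push_cast; ring⟩
  · exact ⟨0, by norm_num⟩

theorem SingleMove.weakMove_of_card_eq_two {α : Type u} {S : Finset α} {π π' : α → ℝ}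
    (hS : S.card = 2) (hπ : IsRankingOn S π) (hπ' : IsRankingOn S π') (h : SingleMove S π π') :
    WeakMove S π π' := by
  obtain ⟨-, -, -, -, -, hne⟩ := h
  obtain ⟨x, y, rfl, hx, hy⟩ := hπ.exists_eq_pair hS
  have hxy : x ≠ y := by rintro rfl; linarith
  have hx' := hπ'.eq_one_or_two hS (x := x) (by simp)
  have hy' := hπ'.eq_one_or_two hS (x := y) (by simp)
  have hinj : π' x ≠ π' y := hπ'.injOn.ne (by simp) (by simp) hxy
  simp only [Finset.mem_insert, Finset.mem_singleton, exists_eq_or_imp, exists_eq_left,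
    hx, hy] at hne
  have hlt : π' y < π' x := by grind
  refine ⟨x, by simp, 2 + 1 / 2, .inl ⟨hx, rfl⟩, ?_, ?_⟩
  · simp only [SameOrderOn, Finset.mem_insert, Finset.mem_singleton, forall_eq_or_imp, forall_eq,
      Function.update_self, Function.update_of_ne hxy.symm, hy]
    grind
  · simpa [hx, hy] using hne

theorem SingleMove.weakMove_of_card_eq_three {α : Type u} {S : Finset α} {π π' : α → ℝ}
    (hS : S.card = 3) (hπ : IsRankingOn S π) (hπ' : IsRankingOn S π') (h : SingleMove S π π') :
    WeakMove S π π' := by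
  obtain ⟨v, hv, p, ⟨m, rfl⟩, hord, hne⟩ := h
  obtain ⟨x, y, z, rfl, hx, hy, hz⟩ := hπ.exists_eq_triple hS
  have hxy : x ≠ y := by rintro rfl; linarith
  have hxz : x ≠ z := by rintro rfl; linarith
  have hyz : y ≠ z := by rintro rfl; linarith
  have hx' := hπ'.eq_one_or_two_or_three hS (x := x) (by simp)
  have hy' := hπ'.eq_one_or_two_or_three hS (x := y) (by simp)
  have hz' := hπ'.eq_one_or_two_or_three hS (x := z) (by simp)
  have hm : (m : ℝ) + 1 / 2 < 1 ∨ (1 < (m : ℝ) + 1 / 2 ∧ (m : ℝ) + 1 / 2 < 2) ∨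
      (2 < (m : ℝ) + 1 / 2 ∧ (m : ℝ) + 1 / 2 < 3) ∨ 3 < (m : ℝ) + 1 / 2 := by
    rcases (by lia : m ≤ 0 ∨ m = 1 ∨ m = 2 ∨ 3 ≤ m) with h | rfl | rfl | h
    · have : (m : ℝ) ≤ 0 := by exact_mod_cast h
      exact .inl (by linarith)
    · norm_num
    · norm_num
    · have : (3 : ℝ) ≤ m := by exact_mod_cast h
      exact .inr (.inr (.inr (by linarith)))
  generalize (m : ℝ) + 1 / 2 = p at hord hm
  have hcard : (({x, y, z} : Finset α).card : ℝ) = 3 := by exact_mod_cast hS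
  have hcases : (π' y < π' x ∧ π' x < π' z) ∨ (π' y < π' z ∧ π' z < π' x) ∨
      (π' x < π' z ∧ π' z < π' y) ∨ (π' z < π' x ∧ π' x < π' y) := by
    simp only [Finset.mem_insert, Finset.mem_singleton, exists_eq_or_imp, exists_eq_left,
      hx, hy, hz] at hne
    simp only [Finset.mem_insert, Finset.mem_singleton] at hv
    simp only [SameOrderOn, Finset.mem_insert, Finset.mem_singleton, forall_eq_or_imp,
      forall_eq] at hord
    have hid : ¬ (π' x < π' y ∧ π' y < π' z) := by
      rintro ⟨h1, h2⟩
      rcases hx' with e | e | e <;> rcases hy' with e' | e' | e' <;>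
        rcases hz' with e'' | e'' | e'' <;> rw [e, e', e''] at hne <;> norm_num at hne <;> linarith
    clear hx' hy' hz' hne
    rcases hv with rfl | rfl | rfl <;>
      simp only [Function.update_self, Function.update_of_ne hxy, Function.update_of_ne hxz,
        Function.update_of_ne hyz, Function.update_of_ne hxy.symm, Function.update_of_ne hxz.symm,
        Function.update_of_ne hyz.symm, hx, hy, hz] at hord <;>
      rcases hm with hm | hm | hm | hm <;> grind
  clear hx' hy' hz' hord hm
  simp only [WeakMove, hcard]
  rcases hcases with h | h | h | h
  · refine ⟨x, by simp, 2 + 1 / 2, by simp [hx], ?_, hne⟩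
    simp only [SameOrderOn, Finset.mem_insert, Finset.mem_singleton, forall_eq_or_imp, forall_eq,
      Function.update_self, Function.update_of_ne hxy.symm,
      Function.update_of_ne hxz.symm, hy, hz]
    grind
  · refine ⟨x, by simp, 3 + 1 / 2, by simp [hx], ?_, hne⟩
    simp only [SameOrderOn, Finset.mem_insert, Finset.mem_singleton, forall_eq_or_imp, forall_eq,
      Function.update_self, Function.update_of_ne hxy.symm,
      Function.update_of_ne hxz.symm, hy, hz]
    grind
  · refine ⟨z, by simp, 3 - 3 / 2, by simp [hz], ?_, hne⟩
    simp only [SameOrderOn, Finset.mem_insert, Finset.mem_singleton, forall_eq_or_imp, forall_eq,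
      Function.update_self, Function.update_of_ne hxz,
      Function.update_of_ne hyz, hx, hy]
    grind
  · refine ⟨z, by simp, 1 / 2, by simp [hz], ?_, hne⟩
    simp only [SameOrderOn, Finset.mem_insert, Finset.mem_singleton, forall_eq_or_imp, forall_eq,
      Function.update_self, Function.update_of_ne hxz,
      Function.update_of_ne hyz, hx, hy]
    grind

/-- for a set `S` of `k` vertices with `k ∈ {2, 3}`, a constraint on `S`
is fragile if and only if it is weakly fragile. -/
theorem fragile_iff_weaklyFragile {α : Type u} (S : Finset α) (k : ℕ)
    (hk : k = 2 ∨ k = 3) (hS : S.card = k) (c : (α → ℝ) → ℕ) :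
    FragileOn S c ↔ WeaklyFragileOn S c := by
  refine ⟨fun h π π' hπ hπ' hm => h π π' hπ hπ' hm.singleMove,
    fun h π π' hπ hπ' hm => h π π' hπ hπ' ?_⟩
  rcases hk with rfl | rfl
  · exact hm.weakMove_of_card_eq_two hS hπ hπ'
  · exact hm.weakMove_of_card_eq_three hS hπ hπ'
end

section
/- For every k ≥ 2 there exists m₀ such that the following holds for all m ≥ m₀. Let c be a fully dense weakly fragile arity-k constraint system on a set U with |U| = m and let σ be an ordering of U. Then for all distinct u, v ∈ U: (1 − 2/10) · (1/3^{k−1}) · C(m−2, k−2) ≤ w̄^σ_{uv} + w̄^σ_{vu} ≤ 2 · C(m−2, k−2). -/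
open scoped Classical

universe u

section Ranking

variable {α : Type u}

theorem rk_mono (S : Finset α) {σ : α → ℝ} {x y : α} (h : σ x ≤ σ y) : rk S σ x ≤ rk S σ y := by
  unfold rk
  apply Finset.card_le_card
  intro z hz
  simp only [Finset.mem_filter] at hz ⊢
  exact ⟨hz.1, hz.2.trans h⟩

theorem rk_lt_rk_iff {S : Finset α} (σ : α → ℝ) {x y : α} (hy : y ∈ S) :
    rk S σ x < rk S σ y ↔ σ x < σ y := by
  constructor
  · intro h
    by_contra hxy
    exact absurd (rk_mono S (not_lt.mp hxy)) (not_le.mpr h)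
  · intro h
    unfold rk
    apply Finset.card_lt_card
    rw [Finset.ssubset_iff_of_subset]
    · refine ⟨y, by simp [hy], by simp [h]⟩
    · intro z hz
      simp only [Finset.mem_filter] at hz ⊢
      exact ⟨hz.1, hz.2.trans h.le⟩

theorem sameOrderOn_rk (S : Finset α) (σ : α → ℝ) :
    SameOrderOn S σ fun x => (rk S σ x : ℝ) := by
  intro x _ y hy
  simp only [Nat.cast_lt, rk_lt_rk_iff σ hy]

theorem rk_injOn {S : Finset α} {σ : α → ℝ} (hσ : IsOrderingOn S σ) :
    Set.InjOn (rk S σ) (S : Set α) := by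
  intro x hx y hy h
  rcases lt_trichotomy (σ x) (σ y) with h' | h' | h'
  · exact absurd h ((rk_lt_rk_iff σ hy).2 h').ne
  · exact hσ hx hy h'
  · exact absurd h ((rk_lt_rk_iff σ hx).2 h').ne'

theorem isRankingOn_rk {S : Finset α} {σ : α → ℝ} (hσ : IsOrderingOn S σ) :
    IsRankingOn S fun x => (rk S σ x : ℝ) := by
  have himage : S.image (rk S σ) = Finset.Icc 1 S.card := by
    apply Finset.eq_of_subset_of_card_le
    · intro n hn
      obtain ⟨x, hx, rfl⟩ := Finset.mem_image.1 hn
      exact Finset.mem_Icc.2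
        ⟨Finset.card_pos.2 ⟨x, by simp [hx]⟩, Finset.card_le_card (Finset.filter_subset _ _)⟩
    · rw [Finset.card_image_of_injOn (rk_injOn hσ)]
      simp
  have hbij : Set.BijOn (rk S σ) (S : Set α) (Set.Icc 1 S.card) := by
    rw [← Finset.coe_Icc, ← himage, Finset.coe_image]
    exact (rk_injOn hσ).bijOn_image
  exact (Nat.cast_injective (R := ℝ)).injOn.bijOn_image.comp hbij

theorem isOrderingOn_moveBefore {S : Finset α} {σ : α → ℝ} (hσ : IsOrderingOn S σ) (v u : α) :
    IsOrderingOn S (moveBefore S σ v u) := by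
  have hhalf : ∀ a b : ℕ, (a : ℝ) ≠ (b : ℝ) - 1 / 2 := by
    intro a b h
    have h2 : (2 * a + 1 : ℝ) = 2 * b := by linarith
    have h3 : 2 * a + 1 = 2 * b := by exact_mod_cast h2
    omega
  intro x hx y hy h
  unfold moveBefore at h
  by_cases hxv : x = v <;> by_cases hyv : y = v
  · rw [hxv, hyv]
  · subst hxv
    rw [Function.update_self, Function.update_of_ne hyv] at h
    exact absurd h.symm (hhalf _ _)
  · subst hyv
    rw [Function.update_self, Function.update_of_ne hxv] at h
    exact absurd h (hhalf _ _)
  · rw [Function.update_of_ne hyv, Function.update_of_ne hxv] at h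
    exact rk_injOn hσ hx hy (by exact_mod_cast h)

theorem SameOrderOn.symm {S : Finset α} {f g : α → ℝ} (h : SameOrderOn S f g) :
    SameOrderOn S g f :=
  fun x hx y hy => (h x hx y hy).symm

theorem SameOrderOn.trans {S : Finset α} {f g h : α → ℝ} (hfg : SameOrderOn S f g)
    (hgh : SameOrderOn S g h) : SameOrderOn S f h :=
  fun x hx y hy => (hfg x hx y hy).trans (hgh x hx y hy)

theorem rk_eq_one {S : Finset α} {σ : α → ℝ} {u : α} (hu : u ∈ S)
    (h : ∀ x ∈ S, x ≠ u → σ u < σ x) : rk S σ u = 1 := by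
  unfold rk
  rw [Finset.card_eq_one]
  refine ⟨u, ?_⟩
  ext x
  simp only [Finset.mem_filter, Finset.mem_singleton]
  constructor
  · rintro ⟨hx, hxu⟩
    by_contra hne
    exact absurd (h x hx hne) (not_lt.2 hxu)
  · rintro rfl
    exact ⟨hu, le_rfl⟩

theorem rk_eq_card {S : Finset α} {σ : α → ℝ} {v : α} (h : ∀ x ∈ S, σ x ≤ σ v) :
    rk S σ v = S.card := by
  unfold rk
  rw [Finset.filter_true_of_mem h]

theorem rk_eq_two {S : Finset α} {σ : α → ℝ} {u v : α} (hu : u ∈ S) (hv : v ∈ S)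
    (huv : σ u < σ v) (h : ∀ x ∈ S, x ≠ u → x ≠ v → σ v < σ x) : rk S σ v = 2 := by
  unfold rk
  rw [Finset.card_eq_two]
  refine ⟨u, v, fun e => huv.ne (congrArg σ e), ?_⟩
  ext x
  simp only [Finset.mem_filter, Finset.mem_insert, Finset.mem_singleton]
  constructor
  · rintro ⟨hx, hxu⟩
    by_contra! hne
    exact absurd (h x hx hne.1 hne.2) (not_lt.2 hxu)
  · rintro (rfl | rfl)
    · exact ⟨hu, huv.le⟩
    · exact ⟨hv, le_rfl⟩

theorem rk_add_one_eq_card {S : Finset α} {σ : α → ℝ} {u v : α} (hv : v ∈ S)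
    (huv : σ u < σ v) (h : ∀ x ∈ S, x ≠ v → σ x ≤ σ u) : rk S σ u + 1 = S.card := by
  have he : (S.filter fun y => σ y ≤ σ u) = S.erase v := by
    ext x
    simp only [Finset.mem_filter, Finset.mem_erase]
    constructor
    · rintro ⟨hx, hxu⟩
      exact ⟨by rintro rfl; exact absurd huv (not_lt.2 hxu), hx⟩
    · rintro ⟨hne, hx⟩
      exact ⟨hx, h x hx hne⟩
  unfold rk
  rw [he, Finset.card_erase_add_one hv]

/-- When `u` and `v` are the first two vertices, placing `v` just before `u` amounts to placing
`u` just after `v`. -/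
theorem sameOrderOn_moveBefore_of_first_two {S : Finset α} {σ : α → ℝ} {u v : α} (hu : u ∈ S)
    (hv : v ∈ S) (huv : σ u < σ v) (h : ∀ x ∈ S, x ≠ u → x ≠ v → σ v < σ x) :
    SameOrderOn S (moveBefore S σ v u)
      (Function.update (fun x => (rk S σ x : ℝ)) u (2 + 1 / 2)) := by
  have hne : u ≠ v := fun e => huv.ne (congrArg σ e)
  have hu1 : rk S σ u = 1 := rk_eq_one hu fun x hx hxu => by
    by_cases hxv : x = v
    · rwa [hxv]
    · exact huv.trans (h x hx hxu hxv)
  have hv2 : rk S σ v = 2 := rk_eq_two hu hv huv h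
  have hge : ∀ x ∈ S, x ≠ u → x ≠ v → (3 : ℝ) ≤ rk S σ x := by
    intro x hx hxu hxv
    have := (rk_lt_rk_iff σ hx).2 (h x hx hxu hxv)
    have h3 : 3 ≤ rk S σ x := by omega
    exact_mod_cast h3
  have hmu : moveBefore S σ v u u = 1 := by
    simp [moveBefore, Function.update_of_ne hne, hu1]
  have hmv : moveBefore S σ v u v = 1 / 2 := by
    simp only [moveBefore, Function.update_self, hu1]; norm_num
  have hm : ∀ x, x ≠ v → moveBefore S σ v u x = rk S σ x := by
    intro x hx
    simp [moveBefore, Function.update_of_ne hx]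
  intro x hx y hy
  by_cases hxu : x = u
  · subst hxu
    by_cases hyu : y = x
    · subst hyu; simp
    by_cases hyv : y = v
    · subst hyv
      rw [hmu, hmv, Function.update_self, Function.update_of_ne hyu, hv2]; norm_num
    · have := hge y hy hyu hyv
      rw [hmu, hm y hyv, Function.update_self, Function.update_of_ne hyu]
      constructor <;> intro <;> linarith
  by_cases hxv : x = v
  · subst hxv
    by_cases hyx : y = x
    · subst hyx; simp
    by_cases hyu : y = u
    · subst hyu
      rw [hmu, hmv, Function.update_self, Function.update_of_ne hxu, hv2]; norm_num
    · have := hge y hy hyu hyx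
      rw [hmv, hm y hyx, Function.update_of_ne hxu, Function.update_of_ne hyu, hv2]
      constructor <;> intro <;> push_cast at * <;> linarith
  have hgx := hge x hx hxu hxv
  by_cases hyu : y = u
  · subst hyu
    rw [hmu, hm x hxv, Function.update_self, Function.update_of_ne hxu]
    constructor <;> intro <;> linarith
  by_cases hyv : y = v
  · subst hyv
    rw [hmv, hm x hxv, Function.update_of_ne hxu, Function.update_of_ne hyu, hv2]
    constructor <;> intro <;> push_cast at * <;> linarith
  · rw [hm x hxv, hm y hyv, Function.update_of_ne hxu, Function.update_of_ne hyu]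

/-- Moving `v` just before `u` is a weak move whenever `u, v` are the last two vertices of `S`,
the two extreme ones, or the first two. -/
theorem WeaklyFragileOn.one_le_add_moveBefore {S : Finset α} {c : (α → ℝ) → ℕ}
    (hc : WeaklyFragileOn S c) (hdep : ∀ f g : α → ℝ, SameOrderOn S f g → c f = c g)
    {σ : α → ℝ} (hσ : IsOrderingOn S σ) {u v : α} (hu : u ∈ S) (hv : v ∈ S) (huv : σ u < σ v)
    (h : (∀ x ∈ S, x ≠ u → x ≠ v → σ x < σ u) ∨
      (∀ x ∈ S, x ≠ u → x ≠ v → σ u < σ x ∧ σ x < σ v) ∨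
      (∀ x ∈ S, x ≠ u → x ≠ v → σ v < σ x)) :
    1 ≤ c σ + c (moveBefore S σ v u) := by
  have hne : u ≠ v := fun e => huv.ne (congrArg σ e)
  set τ := moveBefore S σ v u with hτ
  have hτo : IsOrderingOn S τ := isOrderingOn_moveBefore hσ v u
  have hτs := sameOrderOn_rk S τ
  rw [hdep _ _ (sameOrderOn_rk S σ), hdep _ _ hτs]
  apply hc _ _ (isRankingOn_rk hσ) (isRankingOn_rk hτo)
  have hdiff : ∃ x ∈ S, (rk S σ x : ℝ) ≠ rk S τ x := by
    by_contra! hall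
    have h1 : (rk S σ u : ℝ) < rk S σ v := (sameOrderOn_rk S σ u hu v hv).1 huv
    have h2 : (rk S τ v : ℝ) < rk S τ u := by
      refine (hτs v hv u hu).1 ?_
      simp only [hτ, moveBefore, Function.update_self, Function.update_of_ne hne]
      linarith
    rw [← hall u hu, ← hall v hv] at h2
    exact lt_asymm h1 h2
  rcases h with h | h | h
  · have hle : ∀ x ∈ S, x ≠ v → σ x ≤ σ u := fun x hx hxv => by
      by_cases hxu : x = u
      · rw [hxu]
      · exact (h x hx hxu hxv).le
    have hvk : rk S σ v = S.card := rk_eq_card fun x hx => by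
      by_cases hxv : x = v
      · rw [hxv]
      · exact (hle x hx hxv).trans huv.le
    have huk : (rk S σ u : ℝ) + 1 = S.card := by
      exact_mod_cast rk_add_one_eq_card hv huv hle
    refine ⟨v, hv, (rk S σ u : ℝ) - 1 / 2, ?_, hτs.symm, hdiff⟩
    right; right; left
    exact ⟨by simp [hvk], by linarith⟩
  · have huk : rk S σ u = 1 := rk_eq_one hu fun x hx hxu => by
      by_cases hxv : x = v
      · rwa [hxv]
      · exact (h x hx hxu hxv).1
    have hvk : rk S σ v = S.card := rk_eq_card fun x hx => by
      by_cases hxv : x = v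
      · rw [hxv]
      by_cases hxu : x = u
      · rw [hxu]; exact huv.le
      · exact (h x hx hxu hxv).2.le
    refine ⟨v, hv, (rk S σ u : ℝ) - 1 / 2, ?_, hτs.symm, hdiff⟩
    right; right; right
    exact ⟨by simp [hvk], by rw [huk]; norm_num⟩
  · have huk : rk S σ u = 1 := rk_eq_one hu fun x hx hxu => by
      by_cases hxv : x = v
      · rwa [hxv]
      · exact huv.trans (h x hx hxu hxv)
    refine ⟨u, hu, 2 + 1 / 2, Or.inl ⟨by simp [huk], rfl⟩, ?_, hdiff⟩
    exact hτs.symm.trans (sameOrderOn_moveBefore_of_first_two hu hv huv h)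

end Ranking

section Weights

variable {α : Type u} {U : Finset α} {k : ℕ} {c : Finset α → (α → ℝ) → ℕ} {σ : α → ℝ} {u v : α}

theorem wgt_le_choose (hu : u ∈ U) (hv : v ∈ U) (huv : u ≠ v) :
    wgt U k c σ u v ≤ (U.card - 2).choose (k - 2) := by
  have hcard : ((U.erase u).erase v).card = U.card - 2 := by
    rw [Finset.card_erase_of_mem (Finset.mem_erase.2 ⟨huv.symm, hv⟩), Finset.card_erase_of_mem hu]
    omega
  rw [← hcard, ← Finset.card_powersetCard]
  unfold wgt
  refine (Finset.card_le_card ?_).trans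
    (Finset.card_image_le (f := fun Q => insert u (insert v Q)))
  intro S hS
  obtain ⟨hS, huS, hvS, -⟩ := Finset.mem_filter.1 hS
  obtain ⟨hSU, hSk⟩ := Finset.mem_powersetCard.1 hS
  have hvS' : v ∈ S.erase u := Finset.mem_erase.2 ⟨huv.symm, hvS⟩
  refine Finset.mem_image.2 ⟨(S.erase u).erase v, Finset.mem_powersetCard.2
    ⟨Finset.erase_subset_erase _ (Finset.erase_subset_erase _ hSU), ?_⟩, ?_⟩
  · rw [Finset.card_erase_of_mem hvS', Finset.card_erase_of_mem huS]
    omega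
  · simp only [Finset.insert_erase hvS', Finset.insert_erase huS]

theorem choose_le_wgt_add_wgt (hk : 2 ≤ k) (hc : IsConstraintSystem U k c) (hu : u ∈ U)
    (hv : v ∈ U) (huv : σ u < σ v) {X : Finset α} (hXU : X ⊆ U) (huX : u ∉ X) (hvX : v ∉ X)
    (h : ∀ S ∈ U.powersetCard k, u ∈ S → v ∈ S → (∀ x ∈ S, x ≠ u → x ≠ v → x ∈ X) →
      1 ≤ c S σ + c S (moveBefore S σ v u)) :
    X.card.choose (k - 2) ≤ wgt U k c σ u v + wgt U k c σ v u := by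
  have hne : u ≠ v := fun e => huv.ne (congrArg σ e)
  have hinj : Set.InjOn (fun Q : Finset α => insert u (insert v Q))
      (X.powersetCard (k - 2) : Set (Finset α)) := by
    intro Q hQ R hR hQR
    have hQX := (Finset.mem_powersetCard.1 hQ).1
    have hRX := (Finset.mem_powersetCard.1 hR).1
    have key : ∀ Q : Finset α, Q ⊆ X → ((insert u (insert v Q)).erase u).erase v = Q := by
      intro Q hQ
      rw [Finset.erase_insert (by
        simp only [Finset.mem_insert, not_or]; exact ⟨hne, fun hm => huX (hQ hm)⟩),
        Finset.erase_insert fun hm => hvX (hQ hm)]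
    rw [← key Q hQX, ← key R hRX]
    exact congrArg (fun S => (S.erase u).erase v) hQR
  rw [← Finset.card_powersetCard, ← Finset.card_image_of_injOn hinj]
  unfold wgt
  refine (Finset.card_le_card ?_).trans (Finset.card_union_le _ _)
  intro S hS
  obtain ⟨Q, hQ, rfl⟩ := Finset.mem_image.1 hS
  obtain ⟨hQX, hQk⟩ := Finset.mem_powersetCard.1 hQ
  have hmem : insert u (insert v Q) ∈ U.powersetCard k := by
    refine Finset.mem_powersetCard.2 ⟨?_, ?_⟩
    · exact Finset.insert_subset hu (Finset.insert_subset hv (hQX.trans hXU))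
    · rw [Finset.card_insert_of_notMem (by
        simp only [Finset.mem_insert, not_or]; exact ⟨hne, fun hm => huX (hQX hm)⟩),
        Finset.card_insert_of_notMem fun hm => hvX (hQX hm)]
      omega
  have huS : u ∈ insert u (insert v Q) := by simp
  have hvS : v ∈ insert u (insert v Q) := by simp
  have h1 := h _ hmem huS hvS fun x hx hxu hxv => by
    simp only [Finset.mem_insert, hxu, hxv, false_or] at hx
    exact hQX hx
  have hb := (hc _ hmem).1
  have hb1 := hb σ
  have hb2 := hb (moveBefore (insert u (insert v Q)) σ v u)
  rw [Finset.mem_union, Finset.mem_filter, Finset.mem_filter, if_pos huv, if_neg huv.not_gt]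
  by_cases h0 : c (insert u (insert v Q)) σ = 1
  · exact Or.inr ⟨hmem, hvS, huS, h0⟩
  · exact Or.inl ⟨hmem, huS, hvS, by omega⟩

theorem exists_choose_le_wgt_add_wgt (hk : 2 ≤ k) (hc : IsConstraintSystem U k c)
    (hf : WeaklyFragileSystem U k c) (hσ : IsOrderingOn U σ) (hu : u ∈ U) (hv : v ∈ U)
    (huv : σ u < σ v) :
    ∃ M : ℕ, U.card - 2 ≤ 3 * M ∧ M.choose (k - 2) ≤ wgt U k c σ u v + wgt U k c σ v u := by
  have hne : u ≠ v := fun e => huv.ne (congrArg σ e)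
  set A := U.filter fun x => σ x < σ u with hA
  set B := U.filter fun x => σ u < σ x ∧ σ x < σ v with hB
  set D := U.filter fun x => σ v < σ x with hD
  have fragile : ∀ S ∈ U.powersetCard k, u ∈ S → v ∈ S →
      ((∀ x ∈ S, x ≠ u → x ≠ v → σ x < σ u) ∨
        (∀ x ∈ S, x ≠ u → x ≠ v → σ u < σ x ∧ σ x < σ v) ∨
        (∀ x ∈ S, x ≠ u → x ≠ v → σ v < σ x)) →
      1 ≤ c S σ + c S (moveBefore S σ v u) := fun S hS huS hvS h =>
    (hf S hS).one_le_add_moveBefore (hc S hS).2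
      (hσ.mono (Finset.coe_subset.2 (Finset.mem_powersetCard.1 hS).1)) huS hvS huv h
  have hAw : A.card.choose (k - 2) ≤ wgt U k c σ u v + wgt U k c σ v u := by
    refine choose_le_wgt_add_wgt hk hc hu hv huv (Finset.filter_subset _ _) (by simp [hA])
      (by simp [hA, huv.le]) fun S hS huS hvS h => fragile S hS huS hvS (Or.inl ?_)
    exact fun x hx hxu hxv => (Finset.mem_filter.1 (h x hx hxu hxv)).2
  have hBw : B.card.choose (k - 2) ≤ wgt U k c σ u v + wgt U k c σ v u := by
    refine choose_le_wgt_add_wgt hk hc hu hv huv (Finset.filter_subset _ _) (by simp [hB])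
      (by simp [hB]) fun S hS huS hvS h => fragile S hS huS hvS (Or.inr (Or.inl ?_))
    exact fun x hx hxu hxv => (Finset.mem_filter.1 (h x hx hxu hxv)).2
  have hDw : D.card.choose (k - 2) ≤ wgt U k c σ u v + wgt U k c σ v u := by
    refine choose_le_wgt_add_wgt hk hc hu hv huv (Finset.filter_subset _ _)
      (by simp [hD, huv.le]) (by simp [hD]) fun S hS huS hvS h =>
        fragile S hS huS hvS (Or.inr (Or.inr ?_))
    exact fun x hx hxu hxv => (Finset.mem_filter.1 (h x hx hxu hxv)).2
  have hsum : U.card ≤ A.card + B.card + D.card + 2 := by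
    have hsub : U ⊆ ((A ∪ B) ∪ D) ∪ {u, v} := by
      intro x hx
      simp only [hA, hB, hD, Finset.mem_union, Finset.mem_filter, Finset.mem_insert,
        Finset.mem_singleton, hx, true_and]
      by_contra! hcon
      obtain ⟨⟨⟨h1, h2⟩, h3⟩, h4, h5⟩ := hcon
      have h6 : σ u ≠ σ x := fun e => h4 (hσ hu hx e).symm
      exact h5 (hσ hx hv (le_antisymm h3 (h2 (lt_of_le_of_ne h1 h6))))
    have h1 := Finset.card_le_card hsub
    have h2 := Finset.card_union_le ((A ∪ B) ∪ D) {u, v}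
    have h3 := Finset.card_union_le (A ∪ B) D
    have h4 := Finset.card_union_le A B
    have h5 := Finset.card_le_two (a := u) (b := v)
    omega
  rcases (by omega : U.card - 2 ≤ 3 * A.card ∨ U.card - 2 ≤ 3 * B.card ∨
      U.card - 2 ≤ 3 * D.card) with h | h | h
  exacts [⟨_, h, hAw⟩, ⟨_, h, hBw⟩, ⟨_, h, hDw⟩]

end Weights

/-- Shrinking the ground set by a factor of three costs at most a factor of `3 ^ (j + 1)` in the
number of `j`-subsets, once the ground set is large. -/
theorem choose_le_three_pow_mul_choose {j N M : ℕ} (hN : 6 * j ^ 2 + 3 * j + 3 ≤ N)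
    (hNM : N ≤ 3 * M) : N.choose j ≤ 3 ^ (j + 1) * M.choose j := by
  have hM : 2 * j ^ 2 + j + 1 ≤ M := by omega
  have hbern : (M : ℝ) ^ j ≤ 3 * ((M + 1 - j : ℕ) : ℝ) ^ j := by
    have hMpos : (0 : ℝ) < M := by
      have : 0 < M := by omega
      exact_mod_cast this
    have hM' : (2 * j ^ 2 + j + 1 : ℝ) ≤ M := by exact_mod_cast hM
    have hcast : ((M + 1 - j : ℕ) : ℝ) = M + 1 - j := by
      rw [Nat.cast_sub (by omega)]; push_cast; ring
    have hj0 : (0 : ℝ) ≤ j := Nat.cast_nonneg j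
    have hle : (j : ℝ) / M ≤ 1 := by rw [div_le_one hMpos]; nlinarith
    have hb := one_add_mul_le_pow (a := -((j : ℝ) / M)) (by linarith) j
    have hhalf : (j : ℝ) * (j / M) ≤ 1 / 2 := by
      rw [← mul_div_assoc, div_le_iff₀ hMpos]; nlinarith
    have hpow : (M : ℝ) ^ j * (1 + -((j : ℝ) / M)) ^ j ≤ ((M + 1 - j : ℕ) : ℝ) ^ j := by
      rw [← mul_pow, hcast]
      have he : (M : ℝ) * (1 + -((j : ℝ) / M)) = M - j := by field_simp; ring
      rw [he]
      exact pow_le_pow_left₀ (by nlinarith) (by linarith) j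
    have hMj : (0 : ℝ) < (M : ℝ) ^ j := pow_pos hMpos j
    nlinarith
  have hbern' : M ^ j ≤ 3 * (M + 1 - j) ^ j := by exact_mod_cast hbern
  refine Nat.le_of_mul_le_mul_left ?_ (Nat.factorial_pos j)
  calc j.factorial * N.choose j = N.descFactorial j :=
        (Nat.descFactorial_eq_factorial_mul_choose N j).symm
    _ ≤ N ^ j := Nat.descFactorial_le_pow N j
    _ ≤ (3 * M) ^ j := Nat.pow_le_pow_left hNM j
    _ = 3 ^ j * M ^ j := mul_pow _ _ _
    _ ≤ 3 ^ j * (3 * (M + 1 - j) ^ j) := Nat.mul_le_mul_left _ hbern'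
    _ ≤ 3 ^ j * (3 * M.descFactorial j) := by
        gcongr
        exact Nat.pow_sub_le_descFactorial M j
    _ = j.factorial * (3 ^ (j + 1) * M.choose j) := by
        rw [Nat.descFactorial_eq_factorial_mul_choose]; ring

/-- for fully dense weakly fragile arity-`k` constraint systems on a
sufficiently large set `U` (`|U| = m`) and any ordering `σ` of `U`,
`(1 − 2/10)·(1/3^{k−1})·C(m−2,k−2) ≤ w̄^σ_{uv} + w̄^σ_{vu} ≤ 2·C(m−2,k−2)`. -/
theorem wbar_is_FAST_instance (k : ℕ) (hk : 2 ≤ k) :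
    ∃ m₀ : ℕ, ∀ (α : Type u) (U : Finset α) (m : ℕ), U.card = m → m₀ ≤ m →
      ∀ c : Finset α → (α → ℝ) → ℕ, IsConstraintSystem U k c → WeaklyFragileSystem U k c →
        ∀ σ : α → ℝ, IsOrderingOn U σ → ∀ u ∈ U, ∀ v ∈ U, u ≠ v →
          (1 - 2 / 10) * (1 / 3 ^ (k - 1)) * ((m - 2).choose (k - 2) : ℝ) ≤
              wbar U k c σ u v + wbar U k c σ v u ∧
            wbar U k c σ u v + wbar U k c σ v u ≤ 2 * ((m - 2).choose (k - 2) : ℝ) := by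
  refine ⟨6 * (k - 2) ^ 2 + 3 * (k - 2) + 5, ?_⟩
  intro α U m hm hm₀ c hc hf σ hσ u hu v hv huv
  have lower : ∃ M : ℕ, U.card - 2 ≤ 3 * M ∧
      M.choose (k - 2) ≤ wgt U k c σ u v + wgt U k c σ v u := by
    rcases lt_or_gt_of_ne fun e => huv (hσ hu hv e) with h | h
    · exact exists_choose_le_wgt_add_wgt hk hc hf hσ hu hv h
    · rw [add_comm]
      exact exists_choose_le_wgt_add_wgt hk hc hf hσ hv hu h
  obtain ⟨M, hM, hMw⟩ := lower
  have hchoose := choose_le_three_pow_mul_choose (j := k - 2) (by omega) hM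
  rw [show k - 2 + 1 = k - 1 by omega] at hchoose
  have hsum : ((U.card - 2).choose (k - 2) : ℝ) ≤
      3 ^ (k - 1) * (wgt U k c σ u v + wgt U k c σ v u) := by
    exact_mod_cast hchoose.trans (Nat.mul_le_mul_left _ hMw)
  have hup₁ : (wgt U k c σ u v : ℝ) ≤ (U.card - 2).choose (k - 2) := by
    exact_mod_cast wgt_le_choose hu hv huv
  have hup₂ : (wgt U k c σ v u : ℝ) ≤ (U.card - 2).choose (k - 2) := by
    exact_mod_cast wgt_le_choose hv hu huv.symm
  subst hm
  unfold wbar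
  rw [min_comm (wgt U k c σ v u : ℝ)]
  set t : ℝ := min (1 / (10 * 3 ^ (k - 1)) * ((U.card - 2).choose (k - 2) : ℝ))
    (min (wgt U k c σ u v : ℝ) (wgt U k c σ v u : ℝ)) with ht
  have ht0 : 0 ≤ t := by
    rw [ht]
    exact le_min (by positivity) (le_min (by positivity) (by positivity))
  have ht1 : t ≤ 1 / 10 * (((U.card - 2).choose (k - 2) : ℝ) / 3 ^ (k - 1)) := by
    refine (min_le_left _ _).trans (le_of_eq ?_)
    field_simp
  have hsum' : ((U.card - 2).choose (k - 2) : ℝ) / 3 ^ (k - 1) ≤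
      wgt U k c σ u v + wgt U k c σ v u := by
    rw [div_le_iff₀ (by positivity)]
    linarith
  constructor
  · calc (1 - 2 / 10) * (1 / 3 ^ (k - 1)) * ((U.card - 2).choose (k - 2) : ℝ)
        = (1 - 2 / 10) * (((U.card - 2).choose (k - 2) : ℝ) / 3 ^ (k - 1)) := by ring
      _ ≤ _ := by linarith
  · linarith
end
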